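/- arXiv:1804.07473 — 4 statements merged into one kernel-verified Lean document; each statement's English description precedes it below -/
import Mathlib

section
/- Let f : ℝ → ℝ be a smooth 2π-periodic function with f(t) > −1 for every t ∈ ℝ. Then there exists a smooth 2π-periodic function g : ℝ → ℝ with g(t) > 0 for every t ∈ ℝ, satisfying the differential equation g'(t) − g(t)(1 + f(t)) + 1 = 0 for every t ∈ ℝ. -/
open Real

/-- A smooth function on `ℝ` has a smooth primitive vanishing at `0`. -/
theorem exists_contDiff_primitive {h : ℝ → ℝ} (hh : ContDiff ℝ (⊤ : ℕ∞) h) :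
    ∃ F : ℝ → ℝ, ContDiff ℝ (⊤ : ℕ∞) F ∧ F 0 = 0 ∧ ∀ t, HasDerivAt F (h t) t := by
  have hd : ∀ t, HasDerivAt (fun t => ∫ x in (0 : ℝ)..t, h x) (h t) t := fun t =>
    (hh.continuous.integral_hasStrictDerivAt 0 t).hasDerivAt
  refine ⟨fun t => ∫ x in (0 : ℝ)..t, h x, ?_, by simp, hd⟩
  refine contDiff_infty_iff_deriv.2 ⟨fun t => (hd t).differentiableAt, ?_⟩
  rwa [funext fun t => (hd t).deriv]

/-- If the derivative of `F` is multiplied by `q` under translation by `T` and `F 0 = 0`, then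
translation by `T` acts on `F` as an affine map of slope `q`. -/
theorem primitive_translate {F h : ℝ → ℝ} {T q : ℝ} (hF : ∀ t, HasDerivAt F (h t) t)
    (h0 : F 0 = 0) (hT : ∀ t, h (t + T) = q * h t) (t : ℝ) :
    F (t + T) = F T + q * F t := by
  have hd : ∀ t, HasDerivAt (fun t => F (t + T) - q * F t) 0 t := fun t => by
    refine (((hF (t + T)).comp_add_const t T).sub ((hF t).const_mul q)).congr_deriv ?_
    rw [hT, sub_self]
  have := is_const_of_deriv_eq_zero (fun t => (hd t).differentiableAt) (fun t => (hd t).deriv) t 0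
  simp only [zero_add, h0, mul_zero, sub_zero] at this
  linarith

/-- Given a smooth `2π`-periodic function `f : ℝ → ℝ` with `f > −1`, there exists a smooth
`2π`-periodic positive function `g : ℝ → ℝ` solving `g' − g(1 + f) + 1 = 0`. -/
theorem exists_periodic_positive_solution
    (f : ℝ → ℝ) (hf : ContDiff ℝ (⊤ : ℕ∞) f)
    (hf_per : ∀ t : ℝ, f (t + 2 * π) = f t)
    (hf_gt : ∀ t : ℝ, f t > -1) :
    ∃ g : ℝ → ℝ, ContDiff ℝ (⊤ : ℕ∞) g ∧
      (∀ t : ℝ, g (t + 2 * π) = g t) ∧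
      (∀ t : ℝ, g t > 0) ∧
      (∀ t : ℝ, deriv g t - g t * (1 + f t) + 1 = 0) := by
  obtain ⟨A, hA, hA0, hA'⟩ := exists_contDiff_primitive (contDiff_const (c := (1 : ℝ)).add hf)
  obtain ⟨B, hB, hB0, hB'⟩ := exists_contDiff_primitive (h := fun t => exp (-A t)) hA.neg.exp
  have hAT : ∀ t, A (t + 2 * π) = A (2 * π) + A t := fun t => by
    simpa using primitive_translate (q := 1) hA' hA0 (fun t => by simp [hf_per]) t
  have hBT := primitive_translate (T := 2 * π) (q := exp (-A (2 * π))) hB' hB0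
    (fun t => by rw [hAT, neg_add, exp_add])
  have hA_mono : StrictMono A := strictMono_of_deriv_pos fun t => by
    rw [(hA' t).deriv]; linarith [hf_gt t]
  have hB_mono : StrictMono B := strictMono_of_deriv_pos fun t => by
    rw [(hB' t).deriv]; exact exp_pos _
  have hq : exp (-A (2 * π)) < 1 := by
    have := hA_mono two_pi_pos
    rw [exp_lt_one_iff]; linarith
  set q := exp (-A (2 * π)) with hq_def
  obtain ⟨C, hC⟩ : ∃ C, C * (1 - q) = B (2 * π) :=
    ⟨B (2 * π) / (1 - q), div_mul_cancel₀ _ (by linarith)⟩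
  have hD : ∀ t, C - B (t + 2 * π) = q * (C - B t) := fun t => by
    rw [hBT]; linarith
  refine ⟨fun t => (C - B t) * exp (A t), (contDiff_const.sub hB).mul hA.exp, fun t => ?_,
    fun t => ?_, fun t => ?_⟩
  · have hqe : q * exp (A (2 * π)) = 1 := by rw [hq_def, ← exp_add]; simp
    simp only [hD, hAT, exp_add]
    linear_combination (C - B t) * exp (A t) * hqe
  · have hlt : B t < B (t + 2 * π) := hB_mono (by linarith [two_pi_pos])
    have hpos : 0 < (1 - q) * (C - B t) := by linarith [hD t]
    exact mul_pos (pos_of_mul_pos_right hpos (by linarith)) (exp_pos _)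
  · have hee : exp (-A t) * exp (A t) = 1 := by rw [← exp_add]; simp
    have hg := ((hB' t).const_sub C).mul (hA' t).exp
    rw [show deriv (fun t => (C - B t) * exp (A t)) t = _ from hg.deriv]
    linear_combination -hee
end

section
/- Let f : ℝ → ℝ be a continuous 2π-periodic function and let a, c ∈ ℝ. Define F(t) := a + ∫₀ᵗ (f(s) + 1) ds and g(t) := (c − ∫₀ᵗ e^{−F(s)} ds)·e^{F(t)}, and set b := ∫₀^{2π} (f(s) + 1) ds and K := ∫₀^{2π} e^{−F(s)} ds. Then F(t + 2π) = F(t) + b for every t ∈ ℝ, and g(t + 2π) = g(t) + e^{F(t)}·((c − K)e^{b} − c) for every t ∈ ℝ. In particular, if f(t) > −1 for all t (so that b > 0) and c = K·e^{b}/(e^{b} − 1), then g is 2π-periodic. -/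
open Real

/-- Splitting an integral over `[0, t + T]` at `T` and translating the second part back to `0`. -/
lemma integral_zero_add_eq_add_integral_shift {h : ℝ → ℝ} (hh : Continuous h) (t T : ℝ) :
    ∫ s in (0:ℝ)..(t + T), h s = (∫ s in (0:ℝ)..T, h s) + ∫ s in (0:ℝ)..t, h (s + T) := by
  rw [intervalIntegral.integral_comp_add_right h T, zero_add,
    intervalIntegral.integral_add_adjacent_intervals (hh.intervalIntegrable _ _)
      (hh.intervalIntegrable _ _)]

/-- Quasi-periodicity of `F` and `g`: for `2π`-periodic continuous `f`, with
`F(t) = a + ∫₀ᵗ (f(s)+1) ds`, `g(t) = (c − ∫₀ᵗ e^{−F(s)} ds)·e^{F(t)}`,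
`b = ∫₀^{2π} (f(s)+1) ds` and `K = ∫₀^{2π} e^{−F(s)} ds`, one has
`F(t + 2π) = F(t) + b` and `g(t + 2π) = g(t) + e^{F(t)}((c − K)e^b − c)`.
In particular, if `f > −1` and `c = K e^b/(e^b − 1)` then `g` is `2π`-periodic. -/
theorem quasi_periodicity_of_solution
    (f : ℝ → ℝ) (hf : Continuous f) (hf_per : ∀ t : ℝ, f (t + 2 * π) = f t)
    (a c : ℝ) (F g : ℝ → ℝ) (b K : ℝ)
    (hF : ∀ t : ℝ, F t = a + ∫ s in (0:ℝ)..t, (f s + 1))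
    (hg : ∀ t : ℝ, g t = (c - ∫ s in (0:ℝ)..t, Real.exp (-F s)) * Real.exp (F t))
    (hb : b = ∫ s in (0:ℝ)..(2 * π), (f s + 1))
    (hK : K = ∫ s in (0:ℝ)..(2 * π), Real.exp (-F s)) :
    (∀ t : ℝ, F (t + 2 * π) = F t + b) ∧
    (∀ t : ℝ, g (t + 2 * π) = g t + Real.exp (F t) * ((c - K) * Real.exp b - c)) ∧
    ((∀ t : ℝ, f t > -1) → c = K * Real.exp b / (Real.exp b - 1) →
      ∀ t : ℝ, g (t + 2 * π) = g t) := by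
  have hf1 : Continuous fun s => f s + 1 := hf.add continuous_const
  have hF_cont : Continuous F := by
    rw [funext hF]
    exact continuous_const.add
      (intervalIntegral.continuous_primitive (fun _ _ => hf1.intervalIntegrable _ _) 0)
  have hE_cont : Continuous fun s => Real.exp (-F s) := Real.continuous_exp.comp hF_cont.neg
  have hF_shift : ∀ t : ℝ, F (t + 2 * π) = F t + b := by
    intro t
    rw [hF, hF t, integral_zero_add_eq_add_integral_shift hf1, ← hb]
    simp only [hf_per]
    ring
  have hg_shift : ∀ t : ℝ,
      g (t + 2 * π) = g t + Real.exp (F t) * ((c - K) * Real.exp b - c) := by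
    intro t
    have hI : ∫ s in (0:ℝ)..t, Real.exp (-F (s + 2 * π)) =
        Real.exp (-b) * ∫ s in (0:ℝ)..t, Real.exp (-F s) := by
      rw [← intervalIntegral.integral_const_mul]
      refine intervalIntegral.integral_congr fun s _ => ?_
      simp only [hF_shift, ← Real.exp_add]
      ring_nf
    have hb_inv : Real.exp (-b) * Real.exp b = 1 := by
      rw [← Real.exp_add, neg_add_cancel, Real.exp_zero]
    rw [hg, hg t, integral_zero_add_eq_add_integral_shift hE_cont, ← hK, hI, hF_shift,
      Real.exp_add]
    linear_combination
      (-(∫ s in (0:ℝ)..t, Real.exp (-F s)) * Real.exp (F t)) * hb_inv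
  refine ⟨hF_shift, hg_shift, fun hf_gt hc t => ?_⟩
  have hb_pos : 0 < b := by
    rw [hb]
    exact intervalIntegral.intervalIntegral_pos_of_pos (hf1.intervalIntegrable _ _)
      (fun s => by linarith [hf_gt s]) Real.two_pi_pos
  have hne : Real.exp b - 1 ≠ 0 := (sub_pos.2 (Real.one_lt_exp_iff.2 hb_pos)).ne'
  have hc' : c * (Real.exp b - 1) = K * Real.exp b := (eq_div_iff hne).1 hc
  rw [hg_shift]
  linear_combination Real.exp (F t) * hc'
end

section
/- Let f : ℝ → ℝ be a continuous 2π-periodic function with f(t) > −1 for every t ∈ ℝ, let a ∈ ℝ, define F(t) := a + ∫₀ᵗ (f(s) + 1) ds, b := ∫₀^{2π} (f(s) + 1) ds, K := ∫₀^{2π} e^{−F(s)} ds, and c := K·e^{b}/(e^{b} − 1). Then the function g(t) := (c − ∫₀ᵗ e^{−F(s)} ds)·e^{F(t)} satisfies g(t) > 0 for every t ∈ ℝ. -/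
open Real

/-- For continuous `2π`-periodic `f > −1`, with `F(t) = a + ∫₀ᵗ (f(s)+1) ds`,
`b = ∫₀^{2π} (f(s)+1) ds`, `K = ∫₀^{2π} e^{−F(s)} ds` and `c = K e^b/(e^b − 1)`,
the function `g(t) = (c − ∫₀ᵗ e^{−F(s)} ds)·e^{F(t)}` is everywhere positive. -/
theorem positivity_of_periodic_solution
    (f : ℝ → ℝ) (hf : Continuous f) (hf_per : ∀ t : ℝ, f (t + 2 * π) = f t)
    (hf_gt : ∀ t : ℝ, f t > -1)
    (a : ℝ) (F : ℝ → ℝ) (b K c : ℝ) (g : ℝ → ℝ)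
    (hF : ∀ t : ℝ, F t = a + ∫ s in (0:ℝ)..t, (f s + 1))
    (hb : b = ∫ s in (0:ℝ)..(2 * π), (f s + 1))
    (hK : K = ∫ s in (0:ℝ)..(2 * π), Real.exp (-F s))
    (hc : c = K * Real.exp b / (Real.exp b - 1))
    (hg : ∀ t : ℝ, g t = (c - ∫ s in (0:ℝ)..t, Real.exp (-F s)) * Real.exp (F t)) :
    ∀ t : ℝ, g t > 0 := by
  have hcont : Continuous fun s => f s + 1 := hf.add continuous_const
  have hF_cont : Continuous F := by
    rw [funext hF]
    exact continuous_const.add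
      (intervalIntegral.continuous_primitive (fun u v => hcont.intervalIntegrable u v) 0)
  have hE : Continuous fun s => Real.exp (-F s) := Real.continuous_exp.comp hF_cont.neg
  have hb_pos : 0 < b := by
    rw [hb]
    exact intervalIntegral.intervalIntegral_pos_of_pos (hcont.intervalIntegrable _ _)
      (fun s => by linarith [hf_gt s]) two_pi_pos
  have hF_shift : ∀ t, F (t + 2 * π) = F t + b := by
    intro t
    have hsplit := intervalIntegral.integral_add_adjacent_intervals (μ := MeasureTheory.volume)
      (hcont.intervalIntegrable 0 (2 * π)) (hcont.intervalIntegrable (2 * π) (t + 2 * π))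
    have hsub := intervalIntegral.integral_comp_add_right
      (a := 0) (b := t) (fun s => f s + 1) (2 * π)
    simp only [hf_per, zero_add] at hsub
    rw [hF, hF, hb, ← hsplit, ← hsub]
    ring
  have hI_shift : ∀ t, ∫ s in (0:ℝ)..(t + 2 * π), Real.exp (-F s)
      = K + Real.exp (-b) * ∫ s in (0:ℝ)..t, Real.exp (-F s) := by
    intro t
    have hsub := intervalIntegral.integral_comp_add_right
      (a := 0) (b := t) (fun s => Real.exp (-F s)) (2 * π)
    have hexp : ∀ s, Real.exp (-F (s + 2 * π)) = Real.exp (-b) * Real.exp (-F s) := by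
      intro s
      rw [hF_shift, ← Real.exp_add]
      ring_nf
    simp only [hexp, zero_add, intervalIntegral.integral_const_mul] at hsub
    rw [hK, hsub]
    exact (intervalIntegral.integral_add_adjacent_intervals
      (hE.intervalIntegrable _ _) (hE.intervalIntegrable _ _)).symm
  have hexp_gt : 1 < Real.exp b := Real.one_lt_exp_iff.mpr hb_pos
  have hc_shift : c - K = Real.exp (-b) * c := by
    have hne : Real.exp b - 1 ≠ 0 := by linarith
    rw [hc, Real.exp_neg]
    field_simp
    ring
  intro t
  rw [hg]
  refine mul_pos ?_ (Real.exp_pos _)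
  have hstep : 0 < ∫ s in t..(t + 2 * π), Real.exp (-F s) :=
    intervalIntegral.intervalIntegral_pos_of_pos (hE.intervalIntegrable _ _)
      (fun s => Real.exp_pos _) (by linarith [two_pi_pos])
  have hsplit := intervalIntegral.integral_add_adjacent_intervals (μ := MeasureTheory.volume)
    (hE.intervalIntegrable 0 t) (hE.intervalIntegrable t (t + 2 * π))
  rw [hI_shift] at hsplit
  have hfactor : 0 < 1 - Real.exp (-b) := sub_pos.mpr (Real.exp_lt_one_iff.mpr (by linarith))
  refine pos_of_mul_pos_left (b := 1 - Real.exp (-b)) ?_ hfactor.le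
  linarith
end

section
/- Let f : ℝ → ℝ be a continuous function with f(t) > 0 for every t ∈ ℝ, and let h : ℝ → ℝ be a twice differentiable function satisfying h(0) = 0, h'(0) = 0 and h''(t) + h(t) = f(t) for every t ∈ ℝ. Then for every positive integer n, ∫₀^{2nπ} h(t) dt > 0. -/
open Real

/-- A solution of `h'' + h = f` satisfies `∫₀^{2nπ} h = ∫₀^{2nπ} f(t) (1 - cos t) dt`: the
difference of the integrands is the derivative of `h'(t) (1 - cos t) - h(t) sin t`, which vanishes
at both end points. -/
theorem integral_forced_oscillator_eq {f h : ℝ → ℝ} (hf : Continuous f)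
    (hh : Differentiable ℝ h) (hh' : Differentiable ℝ (deriv h))
    (hode : ∀ t : ℝ, deriv (deriv h) t + h t = f t) (n : ℕ) :
    ∫ t in (0:ℝ)..(2 * n * π), h t = ∫ t in (0:ℝ)..(2 * n * π), f t * (1 - cos t) := by
  have hc : Continuous h := hh.continuous
  have hfc : Continuous fun t ↦ f t * (1 - cos t) := by fun_prop
  have hderiv (t : ℝ) : HasDerivAt (fun t ↦ deriv h t * (1 - cos t) - h t * sin t)
      (f t * (1 - cos t) - h t) t := by
    have := ((hh' t).hasDerivAt.mul ((hasDerivAt_cos t).const_sub 1)).sub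
      ((hh t).hasDerivAt.mul (hasDerivAt_sin t))
    refine this.congr_deriv ?_
    rw [← hode t]
    ring
  have hint := intervalIntegral.integral_eq_sub_of_hasDerivAt
    (a := 0) (b := 2 * n * π) (fun t _ ↦ hderiv t)
    ((hfc.sub hc).intervalIntegrable _ _)
  rw [intervalIntegral.integral_sub (hfc.intervalIntegrable _ _) (hc.intervalIntegrable _ _)]
    at hint
  have hcos : cos (2 * n * π) = 1 := by
    rw [← cos_nat_mul_two_pi n]; ring_nf
  have hsin : sin (2 * n * π) = 0 := by
    rw [← sin_nat_mul_pi (2 * n)]; push_cast; rfl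
  simp only [hcos, hsin, cos_zero, sin_zero, sub_self, mul_zero] at hint
  linarith

/-- If `f : ℝ → ℝ` is continuous and positive, and `h` is twice differentiable with
`h(0) = 0`, `h'(0) = 0` and `h'' + h = f`, then `∫₀^{2nπ} h > 0` for every positive
integer `n`. -/
theorem integral_of_forced_oscillator_pos
    (f : ℝ → ℝ) (hf : Continuous f) (hf_pos : ∀ t : ℝ, f t > 0)
    (h : ℝ → ℝ) (hh : Differentiable ℝ h) (hh' : Differentiable ℝ (deriv h))
    (h0 : h 0 = 0) (h0' : deriv h 0 = 0)
    (hode : ∀ t : ℝ, deriv (deriv h) t + h t = f t) :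
    ∀ n : ℕ, 0 < n → 0 < ∫ t in (0:ℝ)..(2 * n * π), h t := by
  intro n hn
  rw [integral_forced_oscillator_eq hf hh hh' hode n]
  have hn1 : (1 : ℝ) ≤ n := by exact_mod_cast hn
  have hpi_le : π ≤ 2 * n * π := by nlinarith [pi_pos]
  refine intervalIntegral.integral_pos (pi_pos.trans_le hpi_le) (by fun_prop)
    (fun t _ ↦ mul_nonneg (hf_pos t).le (sub_nonneg.2 (cos_le_one t)))
    ⟨π, ⟨pi_pos.le, hpi_le⟩, mul_pos (hf_pos π) ?_⟩
  norm_num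
end
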